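/- arXiv:2401.14495 — 8 statements merged into one kernel-verified Lean document; each statement's English description precedes it below -/
import Mathlib

section
/- Korselt's Criterion: a composite positive integer n is a Carmichael number if and only if n is squarefree and, for every prime p dividing n, (p − 1) divides (n − 1). -/
/-- A Carmichael number: a composite positive integer `n` such that
`n ∣ a ^ n - a` for every integer `a`. -/
def IsCarmichael (n : ℕ) : Prop :=
  1 < n ∧ ¬ n.Prime ∧ ∀ a : ℤ, (n : ℤ) ∣ a ^ n - a

/-- For a prime `p`, the map `a ↦ a ^ n` is the identity on `ZMod p` iff `p - 1 ∣ n - 1`. -/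
theorem ZMod.forall_pow_eq_self_iff {p n : ℕ} (hp : p.Prime) (hn : 0 < n) :
    (∀ a : ZMod p, a ^ n = a) ↔ p - 1 ∣ n - 1 := by
  have : Fact p.Prime := ⟨hp⟩
  obtain ⟨m, rfl⟩ := Nat.exists_eq_add_of_le' hn
  have hunits := FiniteField.forall_pow_eq_one_iff (ZMod p) m
  rw [ZMod.card] at hunits
  rw [Nat.add_sub_cancel, ← hunits]
  constructor
  · intro h u
    have hu := h u
    rw [pow_succ] at hu
    exact Units.ext (by simpa using mul_right_cancel₀ u.ne_zero (hu.trans (one_mul _).symm))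
  · intro h a
    rcases eq_or_ne a 0 with rfl | ha
    · simp
    · have hu := congrArg Units.val (h (Units.mk0 a ha))
      simp only [Units.val_pow_eq_pow_val, Units.val_mk0, Units.val_one] at hu
      rw [pow_succ, hu, one_mul]

/-- For a prime `p`, every integer satisfies `p ∣ a ^ n - a` iff `p - 1 ∣ n - 1`. -/
theorem Int.forall_prime_dvd_pow_sub_self_iff {p n : ℕ} (hp : p.Prime) (hn : 0 < n) :
    (∀ a : ℤ, (p : ℤ) ∣ a ^ n - a) ↔ p - 1 ∣ n - 1 := by
  simp only [← ZMod.forall_pow_eq_self_iff hp hn, ← ZMod.intCast_zmod_eq_zero_iff_dvd,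
    Int.cast_sub, Int.cast_pow, sub_eq_zero,
    (ZMod.intCast_surjective (n := p)).forall]

/-- A squarefree natural number divides `m` as soon as each of its prime factors does. -/
theorem Squarefree.dvd_of_forall_prime_dvd {n m : ℕ} (hn : Squarefree n)
    (h : ∀ p : ℕ, p.Prime → p ∣ n → p ∣ m) : n ∣ m := by
  rw [← Nat.prod_primeFactors_of_squarefree hn]
  exact Finset.prod_primes_dvd m (fun p hp => (Nat.prime_of_mem_primeFactors hp).prime)
    fun p hp => h p (Nat.prime_of_mem_primeFactors hp) (Nat.dvd_of_mem_primeFactors hp)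

/-- If `n ∣ a ^ n - a` for every integer `a`, then `n` is squarefree. -/
theorem squarefree_of_forall_dvd_pow_sub_self {n : ℕ} (hn : 1 < n)
    (h : ∀ a : ℤ, (n : ℤ) ∣ a ^ n - a) : Squarefree n := by
  rw [Nat.squarefree_iff_prime_squarefree]
  intro p hp hpn
  have hdvd : ((p * p : ℕ) : ℤ) ∣ (p : ℤ) ^ n - p := (Int.natCast_dvd_natCast.2 hpn).trans (h p)
  have hpow : ((p * p : ℕ) : ℤ) ∣ (p : ℤ) ^ n := by
    rw [Nat.cast_mul, ← sq]
    exact pow_dvd_pow _ hn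
  have hle := Nat.le_of_dvd hp.pos (Int.natCast_dvd_natCast.1 ((dvd_sub_right hpow).1 hdvd))
  nlinarith [hp.two_le]

/-- Korselt's Criterion. -/
theorem korselt (n : ℕ) (hn : 1 < n) (hcomp : ¬ n.Prime) :
    IsCarmichael n ↔
      Squarefree n ∧ ∀ p : ℕ, p.Prime → p ∣ n → (p - 1) ∣ (n - 1) := by
  have hpos : 0 < n := by lia
  constructor
  · rintro ⟨-, -, h⟩
    exact ⟨squarefree_of_forall_dvd_pow_sub_self hn h, fun p hp hpn =>
      (Int.forall_prime_dvd_pow_sub_self_iff hp hpos).1 fun a =>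
        (Int.natCast_dvd_natCast.2 hpn).trans (h a)⟩
  · rintro ⟨hsq, h⟩
    refine ⟨hn, hcomp, fun a => Int.natCast_dvd.2 (hsq.dvd_of_forall_prime_dvd ?_)⟩
    exact fun p hp hpn =>
      Int.natCast_dvd.1 ((Int.forall_prime_dvd_pow_sub_self_iff hp hpos).2 (h p hp hpn) a)
end

section
/- If n is a Carmichael number and p, q are two distinct primes both dividing n, then p does not divide q − 1; equivalently, q − 1 is coprime to every prime factor of n other than q. -/
/-- If `p` and `q` are distinct primes dividing a Carmichael number `n`,
then `p` does not divide `q - 1`. -/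
theorem prime_factor_not_dvd_pred (n p q : ℕ) (hn : IsCarmichael n)
    (hp : p.Prime) (hq : q.Prime) (hpn : p ∣ n) (hqn : q ∣ n) (hne : p ≠ q) :
    ¬ p ∣ (q - 1) := by
  intro hdvd
  have := Fact.mk hp
  have := Fact.mk hq
  obtain ⟨u, hu⟩ := exists_prime_orderOf_dvd_card (G := (ZMod q)ˣ) p
    (by rwa [ZMod.card_units q])
  obtain ⟨a, ha⟩ := ZMod.intCast_surjective (u : ZMod q)
  have hqa : (q : ℤ) ∣ a ^ n - a := (Int.natCast_dvd_natCast.mpr hqn).trans (hn.2.2 a)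
  have hpow : u ^ n = u := by
    ext
    rw [← ZMod.intCast_zmod_eq_zero_iff_dvd] at hqa
    push_cast at hqa
    rw [ha] at hqa
    exact_mod_cast sub_eq_zero.mp hqa
  have hone : u ^ n = 1 := orderOf_dvd_iff_pow_eq_one.mp (hu ▸ hpn)
  have hu1 : u = 1 := hpow.symm.trans hone
  rw [hu1, orderOf_one] at hu
  exact hp.one_lt.ne hu
end

section
/- Let n be a Carmichael number, let r be a prime divisor of n, and set m = n / r. Then m·r ≡ 1 (mod λ(m)) and (r − 1) divides (m − 1). -/
/-- The Carmichael function `λ(m)`: the exponent of the unit group of `ℤ/mℤ`. -/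
noncomputable def carmichaelLambda (m : ℕ) : ℕ := Monoid.exponent (ZMod m)ˣ

/-- If `n` is a Carmichael number then `λ(d) ∣ n - 1` for every divisor `d` of `n`. -/
theorem IsCarmichael.exponent_units_dvd {n d : ℕ} (hn : IsCarmichael n) (hd : d ∣ n) :
    Monoid.exponent (ZMod d)ˣ ∣ n - 1 := by
  refine Monoid.exponent_dvd_iff_forall_pow_eq_one.mpr fun u => ?_
  obtain ⟨a, ha⟩ := ZMod.intCast_surjective (u : ZMod d)
  have hdvd : (d : ℤ) ∣ a ^ n - a := (Int.natCast_dvd_natCast.mpr hd).trans (hn.2.2 a)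
  have hpow : u ^ n = u := by
    ext
    rw [← CharP.intCast_eq_zero_iff (ZMod d) d] at hdvd
    push_cast at hdvd
    rw [Units.val_pow_eq_pow_val, ← ha]
    exact sub_eq_zero.mp hdvd
  rw [← Nat.sub_add_cancel hn.1.le, pow_succ] at hpow
  exact mul_eq_right.mp hpow

/-- If `n` is a Carmichael number then `r - 1 ∣ n - 1` for every prime divisor `r` of `n`. -/
theorem IsCarmichael.sub_one_dvd {n r : ℕ} (hn : IsCarmichael n) (hr : r.Prime) (hrn : r ∣ n) :
    r - 1 ∣ n - 1 := by
  have : Fact r.Prime := ⟨hr⟩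
  have := ZMod.isCyclic_units_prime hr
  have h := hn.exponent_units_dvd hrn
  rwa [IsCyclic.exponent_eq_card, Nat.card_eq_fintype_card, ZMod.card_units] at h

/-- If `r` is a prime divisor of a Carmichael number `n` and `m = n / r`, then
`m * r ≡ 1 (mod λ(m))` and `(r - 1) ∣ (m - 1)`. -/
theorem cofactor_conditions (n r : ℕ) (hn : IsCarmichael n)
    (hr : r.Prime) (hrn : r ∣ n) :
    (n / r) * r ≡ 1 [MOD carmichaelLambda (n / r)] ∧
      (r - 1) ∣ (n / r - 1) := by
  refine ⟨?_, ?_⟩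
  · rw [Nat.div_mul_cancel hrn]
    exact ((Nat.modEq_iff_dvd' hn.1.le).mpr
      (hn.exponent_units_dvd (Nat.div_dvd_of_dvd hrn))).symm
  · have hm : 1 ≤ n / r := Nat.div_pos (Nat.le_of_dvd (by have := hn.1; lia) hrn) hr.pos
    have hsplit : n - 1 = (r - 1) * (n / r) + (n / r - 1) := by
      have hle : n / r ≤ r * (n / r) := Nat.le_mul_of_pos_left _ hr.pos
      rw [Nat.sub_mul, one_mul]
      have := Nat.mul_div_cancel' hrn
      lia
    exact (Nat.dvd_add_right (dvd_mul_right _ _)).mp (hsplit ▸ hn.sub_one_dvd hr hrn)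
end

section
/- Let n = P·q·r be a Carmichael number, where q < r are primes, P > 1, and every prime factor of P is less than q; let p denote the largest prime factor of P. Then there exist integers C and D with 2 ≤ D < P < C such that, setting Δ = C·D − P², one has Δ > 0, Δ divides (P−1)(P+D), Δ divides (P−1)(P+C), q = (P−1)(P+D)/Δ + 1, r = (P−1)(P+C)/Δ + 1, and P² < C·D < P²·(p+3)/(p+1). -/
/-- One direction of the Korselt criterion: if `n` is a Carmichael number and `q` is a prime factor
of `n`, then `q - 1 ∣ n - 1`. -/
theorem IsCarmichael.prime_sub_one_dvd {n q : ℕ} (hn : IsCarmichael n) (hq : q.Prime)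
    (hqn : q ∣ n) : q - 1 ∣ n - 1 := by
  have : Fact q.Prime := ⟨hq⟩
  obtain ⟨g, hg⟩ := IsCyclic.exists_generator (α := (ZMod q)ˣ)
  have hord : orderOf g = q - 1 := by
    rw [orderOf_eq_card_of_forall_mem_zpowers hg, Nat.card_eq_fintype_card, ZMod.card_units]
  obtain ⟨a, ha⟩ := ZMod.intCast_surjective (g : ZMod q)
  have hdvd : (q : ℤ) ∣ a ^ n - a := (Int.natCast_dvd_natCast.mpr hqn).trans (hn.2.2 a)
  have hpow : g ^ n = g := by
    ext
    have h := (ZMod.intCast_zmod_eq_zero_iff_dvd _ q).mpr hdvd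
    push_cast at h
    rw [ha, sub_eq_zero] at h
    simpa using h
  rw [← hord]
  apply orderOf_dvd_of_pow_eq_one
  have hn1 : 1 ≤ n := hn.1.le
  apply mul_right_cancel (b := g)
  rw [← pow_succ, Nat.sub_add_cancel hn1, hpow, one_mul]

/-- If `x ∣ m * (x + 1) - 1`, then `x ∣ m - 1`; stated with a witness and without subtraction. -/
theorem exists_mul_add_one_eq_of_dvd {x m : ℕ} (hm : 0 < m) (h : x ∣ m * (x + 1) - 1) :
    ∃ c, c * x + 1 = m := by
  have heq : m * (x + 1) - 1 = m * x + (m - 1) := by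
    rw [mul_add, mul_one]; omega
  rw [heq, Nat.dvd_add_right (Dvd.intro_left m rfl)] at h
  obtain ⟨c, hc⟩ := h
  exact ⟨c, by rw [mul_comm, ← hc]; omega⟩

/-- If `P * q * r` is a Carmichael number with primes `q < r`, `P > 1`, and every
prime factor of `P` less than `q`, and `p` is the largest prime factor of `P`,
then there are integers `2 ≤ D < P < C` with `Δ = C*D - P² > 0`,
`Δ ∣ (P-1)(P+D)`, `Δ ∣ (P-1)(P+C)`, `q = (P-1)(P+D)/Δ + 1`,
`r = (P-1)(P+C)/Δ + 1`, and `P² < C*D < P²(p+3)/(p+1)`. -/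
theorem CD_representation (P q r p : ℕ) (hP : 1 < P)
    (hq : q.Prime) (hr : r.Prime) (hqr : q < r)
    (hsmall : ∀ s : ℕ, s.Prime → s ∣ P → s < q)
    (hp_mem : p ∈ P.primeFactors) (hp_max : ∀ s ∈ P.primeFactors, s ≤ p)
    (hcarm : IsCarmichael (P * q * r)) :
    ∃ C D : ℕ, 2 ≤ D ∧ D < P ∧ P < C ∧
      P ^ 2 < C * D ∧
      (C * D - P ^ 2) ∣ (P - 1) * (P + D) ∧
      (C * D - P ^ 2) ∣ (P - 1) * (P + C) ∧
      q = (P - 1) * (P + D) / (C * D - P ^ 2) + 1 ∧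
      r = (P - 1) * (P + C) / (C * D - P ^ 2) + 1 ∧
      C * D * (p + 1) < P ^ 2 * (p + 3) := by
  have hp : p.Prime := Nat.prime_of_mem_primeFactors hp_mem
  have hpP : p ∣ P := Nat.dvd_of_mem_primeFactors hp_mem
  have hpq : p < q := hsmall p hp hpP
  have hp2 := hp.two_le
  have hqdvd := hcarm.prime_sub_one_dvd hq ⟨P * r, by ring⟩
  have hrdvd := hcarm.prime_sub_one_dvd hr ⟨P * q, by ring⟩
  have hqodd : Odd q := hq.odd_of_ne_two (by omega)
  have hrodd : Odd r := hr.odd_of_ne_two (by omega)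
  have hnodd : Odd (P * q * r) := by
    have h2 : 2 ∣ P * q * r - 1 := by
      refine Dvd.dvd.trans ?_ hqdvd
      obtain ⟨k, hk⟩ := hqodd
      exact ⟨k, by omega⟩
    have := hcarm.1
    rw [Nat.odd_iff]
    omega
  have hpodd : Odd p := (Nat.odd_mul.mp (Nat.odd_mul.mp hnodd).1).1.of_dvd_nat hpP
  have hpq2 : p + 2 ≤ q := by
    obtain ⟨_, _⟩ := hpodd; obtain ⟨_, _⟩ := hqodd; omega
  have hqr2 : q + 2 ≤ r := by
    obtain ⟨_, _⟩ := hqodd; obtain ⟨_, _⟩ := hrodd; omega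
  obtain ⟨x, rfl⟩ : ∃ x, q = x + 1 := ⟨q - 1, by omega⟩
  obtain ⟨y, rfl⟩ : ∃ y, r = y + 1 := ⟨r - 1, by omega⟩
  obtain ⟨m, rfl⟩ : ∃ m, P = m + 1 := ⟨P - 1, by omega⟩
  simp only [Nat.add_sub_cancel] at hqdvd hrdvd ⊢
  obtain ⟨C, hC⟩ := exists_mul_add_one_eq_of_dvd (m := (m + 1) * (y + 1)) (by positivity)
    (by convert hqdvd using 2; ring)
  obtain ⟨D, hD⟩ := exists_mul_add_one_eq_of_dvd (m := (m + 1) * (x + 1)) (by positivity) hrdvd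
  have hx : 0 < x := by omega
  have hy : 0 < y := by omega
  have hΔx : C * D * x = (m + 1) ^ 2 * x + m * (m + 1 + D) := by
    zify at hC hD ⊢
    linear_combination (D : ℤ) * hC + (m + 1 : ℤ) * hD
  have hΔy : C * D * y = (m + 1) ^ 2 * y + m * (m + 1 + C) := by
    zify at hC hD ⊢
    linear_combination (C : ℤ) * hD + (m + 1 : ℤ) * hC
  have hCD : (m + 1) ^ 2 < C * D := by
    apply lt_of_mul_lt_mul_right (a := x) _ (Nat.zero_le x)
    have : 0 < m * (m + 1 + D) := by
      have : 0 < m := by omega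
      positivity
    omega
  have hqΔ : m * (m + 1 + D) = (C * D - (m + 1) ^ 2) * x := by
    rw [Nat.sub_mul]; omega
  have hrΔ : m * (m + 1 + C) = (C * D - (m + 1) ^ 2) * y := by
    rw [Nat.sub_mul]; omega
  have hΔ : 0 < C * D - (m + 1) ^ 2 := Nat.sub_pos_of_lt hCD
  refine ⟨C, D, ?_, ?_, ?_, hCD, ⟨x, hqΔ⟩, ⟨y, hrΔ⟩, ?_, ?_, ?_⟩
  · by_contra! hD2
    have hprod : 1 < (m + 1) * (x + 1) := by nlinarith
    interval_cases D
    · omega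
    · rw [one_mul] at hD
      exact Nat.not_prime_mul (by omega) (by omega) (hD ▸ hr)
  · apply lt_of_mul_lt_mul_right (a := y) _ (Nat.zero_le y)
    nlinarith
  · apply lt_of_mul_lt_mul_right (a := x) _ (Nat.zero_le x)
    nlinarith
  · rw [hqΔ, Nat.mul_div_cancel_left _ hΔ]
  · rw [hrΔ, Nat.mul_div_cancel_left _ hΔ]
  · have hbound : C * D * (x * y) < (m + 1) ^ 2 * ((x + 1) * (y + 1)) := by
      calc C * D * (x * y) = (C * x) * (D * y) := by ring
        _ < ((m + 1) * (y + 1)) * ((m + 1) * (x + 1)) :=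
            Nat.mul_lt_mul'' (by omega) (by omega)
        _ = _ := by ring
    have hratio : (p + 1) * ((x + 1) * (y + 1)) ≤ (p + 3) * (x * y) := by
      obtain ⟨a, rfl⟩ : ∃ a, x = p + 1 + a := ⟨x - (p + 1), by omega⟩
      obtain ⟨b, rfl⟩ : ∃ b, y = p + 3 + b := ⟨y - (p + 3), by omega⟩
      nlinarith [Nat.zero_le (a * b), Nat.zero_le (p * a), Nat.zero_le (p * b)]
    apply lt_of_mul_lt_mul_right (a := x * y) _ (Nat.zero_le _)
    calc C * D * (p + 1) * (x * y) = C * D * (x * y) * (p + 1) := by ring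
      _ < (m + 1) ^ 2 * ((x + 1) * (y + 1)) * (p + 1) :=
          Nat.mul_lt_mul_of_pos_right hbound (by omega)
      _ = (m + 1) ^ 2 * ((p + 1) * ((x + 1) * (y + 1))) := by ring
      _ ≤ (m + 1) ^ 2 * ((p + 3) * (x * y)) := Nat.mul_le_mul_left _ hratio
      _ = (m + 1) ^ 2 * (p + 3) * (x * y) := by ring
end

section
/- For each fixed positive integer P > 1, the set of Carmichael numbers of the form n = P·q·r, where q < r are primes and every prime factor of P is less than q, is finite. -/
/-- One direction of Korselt's criterion. -/
theorem IsCarmichael.sub_one_dvd_sub_one {n p : ℕ} (hn : IsCarmichael n) (hp : p.Prime)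
    (hpn : p ∣ n) : p - 1 ∣ n - 1 := by
  have : Fact p.Prime := ⟨hp⟩
  obtain ⟨g, hg⟩ := IsCyclic.exists_generator (α := (ZMod p)ˣ)
  have horder : orderOf g = p - 1 := by
    rw [orderOf_eq_card_of_forall_mem_zpowers hg, Nat.card_eq_fintype_card, ZMod.card_units]
  rw [← horder]
  refine orderOf_dvd_of_pow_eq_one ?_
  obtain ⟨a, ha⟩ := ZMod.intCast_surjective (g : ZMod p)
  have hdvd : (p : ℤ) ∣ a ^ n - a := (Int.natCast_dvd_natCast.mpr hpn).trans (hn.2.2 a)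
  have hpow : g ^ n = g := by
    ext
    have h0 := (ZMod.intCast_zmod_eq_zero_iff_dvd _ p).mpr hdvd
    push_cast [ha] at h0
    simpa using sub_eq_zero.mp h0
  have hn1 : n - 1 + 1 = n := Nat.sub_add_cancel hn.1.le
  rw [← hn1, pow_succ] at hpow
  exact mul_eq_right.mp hpow

/-- If `m * p` is a Carmichael number with `p` prime, then `p - 1 ∣ m - 1`. -/
theorem IsCarmichael.sub_one_dvd_cofactor_sub_one {m p : ℕ} (hn : IsCarmichael (m * p))
    (hp : p.Prime) : (p : ℤ) - 1 ∣ (m : ℤ) - 1 := by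
  have h := Int.natCast_dvd_natCast.mpr (hn.sub_one_dvd_sub_one hp (dvd_mul_left p m))
  rw [Nat.cast_sub hn.1.le, Nat.cast_sub hp.one_le] at h
  push_cast at h
  have heq : (m : ℤ) - 1 = (m * p - 1) - (p - 1) * m := by ring
  rw [heq]
  exact dvd_sub h (dvd_mul_right _ _)

/-- Bounds on `q < r` when `q - 1 ∣ P * r - 1` and `r - 1 ∣ P * q - 1`. -/
theorem le_of_sub_one_dvd_mul_sub_one {P q r : ℤ} (hP : 1 < P) (hq : 1 < q) (hqr : q < r)
    (hqd : q - 1 ∣ P * r - 1) (hrd : r - 1 ∣ P * q - 1) :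
    q ≤ 2 * P ^ 2 + 1 ∧ r ≤ P * (2 * P ^ 2 + 1) := by
  have hPq : 0 < P * q - 1 := by nlinarith
  have hr : r ≤ P * q := by linarith [Int.le_of_dvd hPq hrd]
  obtain ⟨C, hC⟩ := hqd
  obtain ⟨D, hD⟩ := hrd
  have hD0 : 0 < D := pos_of_mul_pos_right (hD ▸ hPq) (by linarith)
  have hDP : D < P := by
    by_contra! h
    nlinarith [mul_le_mul h (show q ≤ r - 1 by linarith) (by linarith) (by linarith)]
  have hdvd : q - 1 ∣ (P - 1) * (P + D) :=
    ⟨C * D - P ^ 2, by linear_combination D * hC + P * hD⟩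
  have hle := Int.le_of_dvd (mul_pos (by linarith) (by linarith)) hdvd
  have hqle : q ≤ 2 * P ^ 2 + 1 := by nlinarith
  exact ⟨hqle, hr.trans (by gcongr)⟩

/-- For each fixed `P > 1`, there are only finitely many Carmichael numbers of the
form `P * q * r` with primes `q < r` and every prime factor of `P` less than `q`. -/
theorem finitely_many_completions (P : ℕ) (hP : 1 < P) :
    {n : ℕ | ∃ q r : ℕ, q.Prime ∧ r.Prime ∧ q < r ∧
      (∀ s : ℕ, s.Prime → s ∣ P → s < q) ∧
      n = P * q * r ∧ IsCarmichael n}.Finite := by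
  refine (Set.finite_Iic (P * (2 * P ^ 2 + 1) * (P * (2 * P ^ 2 + 1)))).subset ?_
  rintro n ⟨q, r, hq, hr, hqr, -, rfl, hn⟩
  have hrd := hn.sub_one_dvd_cofactor_sub_one hr
  have hqd := IsCarmichael.sub_one_dvd_cofactor_sub_one (mul_right_comm P q r ▸ hn) hq
  push_cast at hrd hqd
  obtain ⟨hqle, hrle⟩ := le_of_sub_one_dvd_mul_sub_one (by exact_mod_cast hP)
    (by exact_mod_cast hq.one_lt) (by exact_mod_cast hqr) hqd hrd
  norm_cast at hqle hrle
  exact Nat.mul_le_mul (Nat.mul_le_mul_left P hqle) hrle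
end

section
/- Let n = P·q·r be a Carmichael number, where q < r are primes, P > 1, and every prime factor of P is less than q. Then q < 2P². -/
/-- One direction of Korselt's criterion, for the cofactor `m` of a prime `p` in `p * m`. -/
lemma prime_sub_one_dvd_cofactor_sub_one {p m : ℕ} (hp : p.Prime) (hm : 0 < m)
    (h : ∀ a : ℤ, ((p * m : ℕ) : ℤ) ∣ a ^ (p * m) - a) : p - 1 ∣ m - 1 := by
  have : Fact p.Prime := ⟨hp⟩
  have hpow : ∀ x : ZMod p, x ^ m = x := fun x => by
    obtain ⟨a, rfl⟩ := ZMod.intCast_surjective x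
    have hdvd : (p : ℤ) ∣ a ^ (p * m) - a :=
      (Int.natCast_dvd_natCast.mpr (Dvd.intro m rfl)).trans (h a)
    have hzero := (ZMod.intCast_zmod_eq_zero_iff_dvd _ p).mpr hdvd
    push_cast at hzero
    rwa [pow_mul, ZMod.pow_card, sub_eq_zero] at hzero
  obtain ⟨g, hg⟩ := IsCyclic.exists_generator (α := (ZMod p)ˣ)
  have hcard : orderOf g = p - 1 := by
    rw [orderOf_eq_card_of_forall_mem_zpowers hg, Nat.card_eq_fintype_card, ZMod.card_units]
  rw [← hcard, orderOf_dvd_iff_pow_eq_one]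
  have hgm : g ^ m = g := Units.ext (by simpa using hpow g)
  apply mul_right_cancel (b := g)
  rw [← pow_succ, Nat.sub_add_cancel hm, hgm, one_mul]

/-- If `P * q * r` is a Carmichael number with primes `q < r`, `P > 1`, and every
prime factor of `P` less than `q`, then `q < 2 P²`. -/
theorem q_bound (P q r : ℕ) (hP : 1 < P)
    (hq : q.Prime) (hr : r.Prime) (hqr : q < r)
    (hsmall : ∀ s : ℕ, s.Prime → s ∣ P → s < q)
    (hcarm : IsCarmichael (P * q * r)) :
    q < 2 * P ^ 2 := by
  obtain ⟨-, -, hdvd⟩ := hcarm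
  have hq1 := hq.one_lt
  have hr1 := hr.one_lt
  have hPr : 0 < P * r := by positivity
  have hPq : 0 < P * q := by positivity
  obtain ⟨C, hC⟩ := prime_sub_one_dvd_cofactor_sub_one hq hPr
    (by rwa [show q * (P * r) = P * q * r by ring])
  obtain ⟨D, hD⟩ := prime_sub_one_dvd_cofactor_sub_one hr hPq
    (by rwa [show r * (P * q) = P * q * r by ring])
  zify [hq1.le, hr1.le, Nat.succ_le_of_lt hPr, Nat.succ_le_of_lt hPq] at *
  have hDP : (D : ℤ) < P := by
    by_contra! hle
    nlinarith [mul_le_mul hle (show (q : ℤ) ≤ r - 1 by lia) (by lia) (by lia)]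
  have key : ((C : ℤ) * D - P ^ 2) * (q - 1) = (P - 1) * (P + D) := by
    linear_combination (-(D : ℤ)) * hC - (P : ℤ) * hD
  have hpos : 0 < (C : ℤ) * D - P ^ 2 := by
    have : 0 < ((C : ℤ) * D - P ^ 2) * (q - 1) := by
      rw [key]
      exact mul_pos (by lia) (by lia)
    exact pos_of_mul_pos_left this (by lia)
  have hle : (q : ℤ) - 1 ≤ (P - 1) * (P + D) := by
    rw [← key]
    exact le_mul_of_one_le_left (by lia) hpos
  nlinarith
end

section
/- For all positive integers N and L and every natural number a, the number of positive divisors d of N with d ≡ a (mod L) is at most 2·√(N/L) + 2. -/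
/-- The divisors `d` in a residue class mod `L` with `d / L ≤ k` are determined by `d / L`, and the
others by `N / d ≤ k`, where `k = ⌊√(N / L)⌋`. -/
theorem card_divisors_filter_mod_le (N L a : ℕ) (hL : 0 < L) :
    (N.divisors.filter (fun d => d % L = a % L)).card ≤ 2 * (N / L).sqrt + 2 := by
  set k := (N / L).sqrt
  set S := N.divisors.filter (fun d => d % L = a % L) with hS
  have small : (S.filter (fun d => d / L ≤ k)).card ≤ k + 1 := by
    rw [← Finset.card_range (k + 1)]
    refine Finset.card_le_card_of_injOn (fun d => d / L) ?_ ?_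
    · intro d hd
      simp only [Finset.coe_filter, Set.mem_ofPred_eq] at hd
      simpa using Nat.lt_succ_of_le hd.2
    · intro d hd e he hde
      simp only [hS, Finset.coe_filter, Finset.mem_filter, Set.mem_ofPred_eq] at hd he
      rw [← Nat.div_add_mod d L, ← Nat.div_add_mod e L, hd.1.2, he.1.2]
      simp only at hde
      rw [hde]
  have large : (S.filter (fun d => ¬ d / L ≤ k)).card ≤ k + 1 := by
    rw [← Finset.card_range (k + 1)]
    refine Finset.card_le_card_of_injOn (fun d => N / d) ?_ ?_
    · intro d hd
      simp only [Finset.coe_filter, Set.mem_ofPred_eq, not_le] at hd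
      have hkd : (k + 1) * L ≤ d := (Nat.le_div_iff_mul_le hL).1 hd.2
      have hN : N < (k + 1) * (k + 1) * L :=
        (Nat.div_lt_iff_lt_mul hL).1 (Nat.lt_succ_sqrt (N / L))
      have hd0 : 0 < d := lt_of_lt_of_le (by positivity) hkd
      simp only [Finset.coe_range, Set.mem_Iio]
      rw [Nat.div_lt_iff_lt_mul hd0]
      calc N < (k + 1) * ((k + 1) * L) := by rwa [← mul_assoc]
        _ ≤ (k + 1) * d := Nat.mul_le_mul_left _ hkd
    · intro d hd e he hde
      simp only [hS, Finset.coe_filter, Finset.mem_filter, Nat.mem_divisors,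
        Set.mem_ofPred_eq] at hd he
      simp only at hde
      rw [← Nat.div_div_self hd.1.1.1 hd.1.1.2, hde, Nat.div_div_self he.1.1.1 he.1.1.2]
  rw [← Finset.card_filter_add_card_filter_not (s := S) (fun d => d / L ≤ k)]
  omega

/-- For positive integers `N` and `L` and any natural number `a`, the number of
positive divisors `d` of `N` with `d ≡ a (mod L)` is at most `2·√(N/L) + 2`. -/
theorem divisors_in_residue_class_bound (N L : ℕ) (hN : 0 < N) (hL : 0 < L)
    (a : ℕ) :
    ((N.divisors.filter (fun d => d % L = a % L)).card : ℝ) ≤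
      2 * Real.sqrt ((N : ℝ) / (L : ℝ)) + 2 := by
  have hcard : ((N.divisors.filter (fun d => d % L = a % L)).card : ℝ) ≤
      2 * ((N / L).sqrt : ℝ) + 2 := by
    exact_mod_cast card_divisors_filter_mod_le N L a hL
  have hsqrt : ((N / L).sqrt : ℝ) ≤ Real.sqrt ((N : ℝ) / (L : ℝ)) :=
    Real.nat_sqrt_le_real_sqrt.trans (Real.sqrt_le_sqrt Nat.cast_div_le)
  linarith
end

section
/- Every Carmichael number n is a cyclic number, i.e., n is coprime to φ(n), where φ is Euler's totient function. -/
/-- Every Carmichael number is a cyclic number: `n` is coprime to `φ(n)`. -/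
theorem carmichael_is_cyclic (n : ℕ) (hn : IsCarmichael n) :
    Nat.Coprime n (Nat.totient n) := by
  obtain ⟨hn_one, -, hdvd⟩ := hn
  have : NeZero n := ⟨by omega⟩
  refine Nat.Coprime.symm (Nat.coprime_of_dvd fun p hp hpφ hpn => ?_)
  have : Fact p.Prime := ⟨hp⟩
  rw [← ZMod.card_units_eq_totient] at hpφ
  -- By the theorem of Cauchy there is a unit `u` modulo `n` of order `p`.
  obtain ⟨u, hu⟩ := exists_prime_orderOf_dvd_card p hpφ
  -- The Carmichael property gives `u ^ n = u`, while `p ∣ n` gives `u ^ n = 1`.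
  have hpow : u ^ n = u := by
    obtain ⟨a, ha⟩ := ZMod.intCast_surjective (u : ZMod n)
    have h := (ZMod.intCast_zmod_eq_zero_iff_dvd (a ^ n - a) n).2 (hdvd a)
    push_cast at h
    rw [ha, sub_eq_zero] at h
    exact Units.ext (by simpa using h)
  have hu_one : u = 1 := hpow.symm.trans (orderOf_dvd_iff_pow_eq_one.1 (hu ▸ hpn))
  exact hp.one_lt.ne' (hu.symm.trans (orderOf_eq_one_iff.2 hu_one))
end
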